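/- Let π₁, …, π_m be probability density functions on a σ-finite measure space and α₁, …, α_m ≥ 0 with Σ α_i = 1, and suppose the normalizing constant c = ∫ ∏_{i=1}^m π_i(θ)^{α_i} dθ is finite and strictly positive. Then among all probability densities η (absolutely continuous with respect to each π_i, with all relevant integrals finite), the weighted average Kullback–Leibler divergence d(η) = Σ_{i=1}^m α_i ∫ η(θ) log(η(θ)/π_i(θ)) dθ is minimized by the normalized geometric mean prior π_G(θ) = c^{-1} ∏_{i=1}^m π_i(θ)^{α_i}; equivalently, for every such η, d(η) ≥ d(π_G) = −log c, with equality if and only if η = π_G almost everywhere. -/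

import Mathlib

open MeasureTheory

/-- Pointwise form of the compensation identity for the weighted geometric mean. -/
lemma sum_mul_mul_log_div_eq {ι : Type*} [Fintype ι] {α p : ι → ℝ} {c q : ℝ}
    (hα_sum : ∑ i, α i = 1) (hc : 0 < c) (hq : 0 ≤ q)
    (hqp : 0 < q → ∀ i, α i ≠ 0 → 0 < p i) :
    ∑ i, α i * (q * Real.log (q / p i)) =
      q * Real.log (q / (c⁻¹ * ∏ i, p i ^ α i)) - q * Real.log c := by
  rcases hq.eq_or_lt with rfl | hq
  · simp
  have hfac : ∀ i, 0 < p i ^ α i := fun i => by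
    by_cases h : α i = 0
    · simp [h]
    · exact Real.rpow_pos_of_pos (hqp hq i h) _
  have hprod : 0 < ∏ i, p i ^ α i := Finset.prod_pos fun i _ => hfac i
  have hlog : Real.log (∏ i, p i ^ α i) = ∑ i, α i * Real.log (p i) := by
    rw [Real.log_prod fun i _ => (hfac i).ne']
    refine Finset.sum_congr rfl fun i _ => ?_
    by_cases h : α i = 0
    · simp [h]
    · exact Real.log_rpow (hqp hq i h) _
  have hterm : ∀ i, α i * (q * Real.log (q / p i)) =
      α i * (q * Real.log q) - q * (α i * Real.log (p i)) := fun i => by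
    by_cases h : α i = 0
    · simp [h]
    · rw [Real.log_div hq.ne' (hqp hq i h).ne']
      ring
  rw [Finset.sum_congr rfl fun i _ => hterm i, Finset.sum_sub_distrib, ← Finset.sum_mul,
    ← Finset.mul_sum, hα_sum, Real.log_div hq.ne' (by positivity),
    Real.log_mul (inv_ne_zero hc.ne') hprod.ne', Real.log_inv, hlog]
  ring

/-- The pointwise Gibbs inequality. -/
lemma sub_le_mul_log_div {x y : ℝ} (hx : 0 ≤ x) (hy : 0 ≤ y) (hxy : 0 < x → 0 < y) :
    x - y ≤ x * Real.log (x / y) := by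
  rcases hx.eq_or_lt with rfl | hx
  · simpa using hy
  have hy := hxy hx
  have h := Real.log_le_sub_one_of_pos (div_pos hy hx)
  rw [← inv_div, Real.log_inv]
  have h2 := mul_le_mul_of_nonneg_left h hx.le
  have h3 : x * (y / x - 1) = y - x := by field_simp
  linarith

/-- The equality case of the pointwise Gibbs inequality. -/
lemma eq_of_mul_log_div_eq_sub {x y : ℝ} (hx : 0 ≤ x) (hxy : 0 < x → 0 < y)
    (h : x * Real.log (x / y) = x - y) : x = y := by
  rcases hx.eq_or_lt with rfl | hx
  · simp at h
    linarith
  have hy := hxy hx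
  by_contra hne
  have hlt := Real.log_lt_sub_one_of_pos (div_pos hy hx)
    (fun h1 => hne ((div_eq_one_iff_eq hx.ne').1 h1).symm)
  rw [← inv_div, Real.log_inv] at h
  have h2 := mul_lt_mul_of_pos_left hlt hx
  have h3 : x * (y / x - 1) = y - x := by field_simp
  linarith

/-- The normalized weighted geometric mean `πG = c⁻¹ * ∏ i, π i ^ α i` of probability
densities `π i` (with nonnegative weights `α i` summing to `1` and finite positive
normalizing constant `c = ∫ ∏ i, π i ^ α i`) minimizes the weighted average
Kullback–Leibler divergence `d(η) = ∑ i, α i * ∫ η * log (η / π i)`: for every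
admissible density `η`, `d(η) ≥ d(πG) = -log c`, with equality iff `η = πG` a.e. -/
theorem geometric_mean_minimizes_weighted_KL
    {Ω : Type*} [MeasurableSpace Ω] (μm : Measure Ω) [SigmaFinite μm]
    (m : ℕ) (π : Fin m → Ω → ℝ)
    (hπ_meas : ∀ i, Measurable (π i)) (hπ_nonneg : ∀ i θ, 0 ≤ π i θ)
    (hπ_prob : ∀ i, ∫ θ, π i θ ∂μm = 1)
    (α : Fin m → ℝ) (hα_nonneg : ∀ i, 0 ≤ α i) (hα_sum : ∑ i, α i = 1)
    (c : ℝ)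
    (hc_int : Integrable (fun θ => ∏ i, π i θ ^ α i) μm)
    (hc_def : c = ∫ θ, ∏ i, π i θ ^ α i ∂μm)
    (hc_pos : 0 < c)
    (πG : Ω → ℝ) (hπG_def : ∀ θ, πG θ = c⁻¹ * ∏ i, π i θ ^ α i)
    (hπG_int : ∀ i, Integrable (fun θ => πG θ * Real.log (πG θ / π i θ)) μm)
    (η : Ω → ℝ) (hη_meas : Measurable η) (hη_nonneg : ∀ θ, 0 ≤ η θ)
    (hη_prob : ∫ θ, η θ ∂μm = 1)
    (hη_ac : ∀ i θ, 0 < η θ → 0 < π i θ)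
    (hη_int : ∀ i, Integrable (fun θ => η θ * Real.log (η θ / π i θ)) μm)
    (hη_int' : Integrable (fun θ => η θ * Real.log (η θ / πG θ)) μm) :
    (∑ i, α i * ∫ θ, η θ * Real.log (η θ / π i θ) ∂μm ≥ -Real.log c)
    ∧ (∑ i, α i * ∫ θ, πG θ * Real.log (πG θ / π i θ) ∂μm = -Real.log c)
    ∧ ((∑ i, α i * ∫ θ, η θ * Real.log (η θ / π i θ) ∂μm = -Real.log c)
        ↔ η =ᵐ[μm] πG) := by
  have hprod_nonneg : ∀ θ, 0 ≤ ∏ i, π i θ ^ α i := fun θ =>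
    Finset.prod_nonneg fun i _ => Real.rpow_nonneg (hπ_nonneg i θ) _
  have hG_nonneg : ∀ θ, 0 ≤ πG θ := fun θ => by
    rw [hπG_def]
    exact mul_nonneg (inv_nonneg.2 hc_pos.le) (hprod_nonneg θ)
  have hG_eq : πG = fun θ => c⁻¹ * ∏ i, π i θ ^ α i := funext hπG_def
  have hG_int : Integrable πG μm := hG_eq ▸ hc_int.const_mul c⁻¹
  have hG_prob : ∫ θ, πG θ ∂μm = 1 := by
    simp_rw [hπG_def]
    rw [integral_const_mul, ← hc_def, inv_mul_cancel₀ hc_pos.ne']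
  have hη_integrable : Integrable η μm :=
    Integrable.of_integral_ne_zero (by rw [hη_prob]; exact one_ne_zero)
  have hηG : ∀ θ, 0 < η θ → 0 < πG θ := fun θ h => by
    rw [hπG_def]
    exact mul_pos (inv_pos.2 hc_pos)
      (Finset.prod_pos fun i _ => Real.rpow_pos_of_pos (hη_ac i θ h) _)
  have hGπ : ∀ θ, 0 < πG θ → ∀ i, α i ≠ 0 → 0 < π i θ := fun θ h i hi => by
    refine (hπ_nonneg i θ).lt_of_ne fun h0 => h.ne' ?_
    rw [hπG_def, Finset.prod_eq_zero (Finset.mem_univ i), mul_zero]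
    rw [← h0, Real.zero_rpow hi]
  have hdη : ∑ i, α i * ∫ θ, η θ * Real.log (η θ / π i θ) ∂μm =
      ∫ θ, η θ * Real.log (η θ / πG θ) ∂μm - Real.log c := by
    simp_rw [← integral_const_mul]
    rw [← integral_finsetSum _ fun i _ => (hη_int i).const_mul (α i)]
    have hpt : ∀ θ, ∑ i, α i * (η θ * Real.log (η θ / π i θ)) =
        η θ * Real.log (η θ / πG θ) - η θ * Real.log c := fun θ => by
      rw [hπG_def]
      exact sum_mul_mul_log_div_eq hα_sum hc_pos (hη_nonneg θ) fun h i _ => hη_ac i θ h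
    simp_rw [hpt]
    rw [integral_sub hη_int' (hη_integrable.mul_const _), integral_mul_const, hη_prob, one_mul]
  have hdG : ∑ i, α i * ∫ θ, πG θ * Real.log (πG θ / π i θ) ∂μm = -Real.log c := by
    simp_rw [← integral_const_mul]
    rw [← integral_finsetSum _ fun i _ => (hπG_int i).const_mul (α i)]
    have hpt : ∀ θ, ∑ i, α i * (πG θ * Real.log (πG θ / π i θ)) = πG θ * -Real.log c :=
      fun θ => by
        rw [sum_mul_mul_log_div_eq hα_sum hc_pos (hG_nonneg θ) (hGπ θ), ← hπG_def]
        by_cases h : πG θ = 0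
        · simp [h]
        · simp [div_self h]
    simp_rw [hpt]
    rw [integral_mul_const, hG_prob, one_mul]
  have hgap_nonneg : ∀ θ, 0 ≤ η θ * Real.log (η θ / πG θ) - (η θ - πG θ) := fun θ =>
    sub_nonneg.2 (sub_le_mul_log_div (hη_nonneg θ) (hG_nonneg θ) (hηG θ))
  have hgap_int : Integrable (fun θ => η θ * Real.log (η θ / πG θ) - (η θ - πG θ)) μm :=
    hη_int'.sub (hη_integrable.sub hG_int)
  have hgap : ∫ θ, (η θ * Real.log (η θ / πG θ) - (η θ - πG θ)) ∂μm =
      ∫ θ, η θ * Real.log (η θ / πG θ) ∂μm := by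
    have hsub_int : Integrable (fun θ => η θ - πG θ) μm := hη_integrable.sub hG_int
    rw [integral_sub hη_int' hsub_int, integral_sub hη_integrable hG_int,
      hη_prob, hG_prob, sub_self, sub_zero]
  refine ⟨?_, hdG, fun h => ?_, fun h => ?_⟩
  · have := integral_nonneg_of_ae (Filter.Eventually.of_forall (f := ae μm) hgap_nonneg)
    linarith
  · have hzero := (integral_eq_zero_iff_of_nonneg hgap_nonneg hgap_int).1 (by linarith)
    filter_upwards [hzero] with θ hθ
    exact eq_of_mul_log_div_eq_sub (hη_nonneg θ) (hηG θ) (sub_eq_zero.1 hθ)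
  · rw [← hdG]
    refine Finset.sum_congr rfl fun i _ => congrArg (α i * ·) (integral_congr_ae ?_)
    filter_upwards [h] with θ hθ
    rw [hθ]
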